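/- Let k be a field and R = k[[x,y]]/(x^3 + y^2), with maximal ideal 𝔪 = (x, y) (generated by the residue classes of x and y). Then there is a short exact sequence 0 → 𝔪 → R^{⊕2} → 𝔪 → 0 of R-modules, and consequently R^{⊕2} ⇒_deg 𝔪^{⊕2}. -/

import Mathlib

open Polynomial TensorProduct

noncomputable section

/-- The prime ideal `(t)` of the polynomial ring `k[t]`. -/
def tIdeal (k : Type) [Field k] : Ideal (Polynomial k) := Ideal.span {Polynomial.X}

instance tIdeal_isPrime (k : Type) [Field k] : (tIdeal k).IsPrime := by
  have h : tIdeal k = RingHom.ker (Polynomial.evalRingHom (0 : k)) := by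
    rw [Polynomial.ker_evalRingHom]
    simp [tIdeal]
  rw [h]
  exact RingHom.ker_isPrime _

/-- `V = k[t]_{(t)}`, the localization of the polynomial ring `k[t]` at the prime ideal `(t)`. -/
def DegV (k : Type) [Field k] : Type := Localization.AtPrime (tIdeal k)

instance (k : Type) [Field k] : CommRing (DegV k) :=
  inferInstanceAs (CommRing (Localization.AtPrime (tIdeal k)))

instance (k : Type) [Field k] : Algebra (Polynomial k) (DegV k) :=
  inferInstanceAs (Algebra (Polynomial k) (Localization.AtPrime (tIdeal k)))

instance (k : Type) [Field k] : Algebra k (DegV k) :=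
  inferInstanceAs (Algebra k (Localization.AtPrime (tIdeal k)))

instance (k : Type) [Field k] : IsScalarTower k (Polynomial k) (DegV k) :=
  inferInstanceAs (IsScalarTower k (Polynomial k) (Localization.AtPrime (tIdeal k)))

/-- The element `t` of `V = k[t]_{(t)}`. -/
def degT (k : Type) [Field k] : DegV k := algebraMap (Polynomial k) (DegV k) Polynomial.X

/-- `K = V[t⁻¹]`, which is the fraction field `k(t)` of `V = k[t]_{(t)}`. -/
def DegK (k : Type) [Field k] : Type := Localization (Submonoid.powers (degT k))

instance (k : Type) [Field k] : CommRing (DegK k) :=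
  inferInstanceAs (CommRing (Localization (Submonoid.powers (degT k))))

instance (k : Type) [Field k] : Algebra (DegV k) (DegK k) :=
  inferInstanceAs (Algebra (DegV k) (Localization (Submonoid.powers (degT k))))

instance (k : Type) [Field k] : Algebra k (DegK k) :=
  inferInstanceAs (Algebra k (Localization (Submonoid.powers (degT k))))

/-- The localized module `Q[t⁻¹]` is a module over `K = V[t⁻¹]`. -/
instance (k : Type) [Field k] (Q : Type) [AddCommGroup Q] [Module (DegV k) Q] :
    Module (DegK k) (LocalizedModule (Submonoid.powers (degT k)) Q) :=
  inferInstanceAs (Module (Localization (Submonoid.powers (degT k)))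
    (LocalizedModule (Submonoid.powers (degT k)) Q))

section

variable (k : Type) [Field k] (R : Type) [Ring R] [Algebra k R]

/-- `1 ⊗ t` is central in `R ⊗[k] V`. -/
theorem degT_central (x : R ⊗[k] DegV k) :
    x * ((1 : R) ⊗ₜ[k] degT k) = ((1 : R) ⊗ₜ[k] degT k) * x := by
  induction x with
  | zero => simp
  | tmul a v => simp [Algebra.TensorProduct.tmul_mul_tmul, mul_comm]
  | add x y hx hy => simp [add_mul, mul_add, hx, hy]

/-- Multiplication by `1 ⊗ t` on an `R ⊗[k] V`-module, as an `R ⊗[k] V`-linear map. -/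
def tSmul (Q : Type) [AddCommGroup Q] [Module (R ⊗[k] DegV k) Q] :
    Q →ₗ[R ⊗[k] DegV k] Q where
  toFun q := ((1 : R) ⊗ₜ[k] degT k) • q
  map_add' := smul_add _
  map_smul' x q := by
    simp only [RingHom.id_apply, ← mul_smul, degT_central]

/-- The `R`-module structure on an `R ⊗[k] V`-module obtained by restriction of scalars
along `R → R ⊗[k] V`. -/
def rRestrict (Q : Type) [AddCommGroup Q] [Module (R ⊗[k] DegV k) Q] : Module R Q :=
  Module.compHom Q (Algebra.TensorProduct.includeLeftRingHom : R →+* R ⊗[k] DegV k)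

/-- The `V`-module structure on an `R ⊗[k] V`-module obtained by restriction of scalars
along `V → R ⊗[k] V`. -/
def vRestrict (Q : Type) [AddCommGroup Q] [Module (R ⊗[k] DegV k) Q] : Module (DegV k) Q :=
  Module.compHom Q
    ((Algebra.TensorProduct.includeRight : DegV k →ₐ[k] R ⊗[k] DegV k) : DegV k →+* R ⊗[k] DegV k)

/-- The action of `r : R` on an `R ⊗[k] V`-module `Q`, as a `V`-linear endomorphism of `Q`. -/
def rAct (Q : Type) [AddCommGroup Q] [Module (R ⊗[k] DegV k) Q] (r : R) :
    letI := vRestrict k R Q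
    Q →ₗ[DegV k] Q :=
  letI := vRestrict k R Q
  { toFun := fun q => (r ⊗ₜ[k] (1 : DegV k)) • q
    map_add' := smul_add _
    map_smul' := fun v q => by
      show (r ⊗ₜ[k] (1 : DegV k)) • (((1 : R) ⊗ₜ[k] v) • q)
        = ((1 : R) ⊗ₜ[k] v) • ((r ⊗ₜ[k] (1 : DegV k)) • q)
      rw [← mul_smul, ← mul_smul, Algebra.TensorProduct.tmul_mul_tmul,
        Algebra.TensorProduct.tmul_mul_tmul, one_mul, mul_one, one_mul, mul_one] }

/-- The action of `r : R` on a module `M`, as a `k`-linear endomorphism of `M`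
(where `M` is viewed as a `k`-module by restriction of scalars along `k → R`). -/
def rActK (M : Type) [AddCommGroup M] [Module R M] (r : R) :
    letI := Module.compHom M (algebraMap k R)
    M →ₗ[k] M :=
  letI := Module.compHom M (algebraMap k R)
  { toFun := fun m => r • m
    map_add' := smul_add r
    map_smul' := fun c m => by
      show r • ((algebraMap k R c) • m) = (algebraMap k R c) • (r • m)
      rw [← mul_smul, ← mul_smul, Algebra.commutes] }

/-- Degeneration of modules (Yoshino): `M ⇒_deg N` iff there is a finitely generated
`R ⊗[k] V`-module `Q`, flat over `V`, with `Q/tQ ≅ N` as `R`-modules and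
`Q_t = Q[t⁻¹] ≅ M ⊗[k] K` compatibly with the `R`- and `K`-actions
(i.e. as `R ⊗[k] K`-modules). -/
def Degenerates (M N : Type) [AddCommGroup M] [Module R M] [AddCommGroup N] [Module R N] :
    Prop :=
  ∃ (Q : Type) (_ : AddCommGroup Q) (_ : Module (R ⊗[k] DegV k) Q),
    Module.Finite (R ⊗[k] DegV k) Q ∧
    (letI := vRestrict k R Q; Module.Flat (DegV k) Q) ∧
    -- `Q/tQ ≅ N` as `R`-modules
    (letI := rRestrict k R (Q ⧸ LinearMap.range (tSmul k R Q))
     Nonempty ((Q ⧸ LinearMap.range (tSmul k R Q)) ≃ₗ[R] N)) ∧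
    -- `Q_t ≅ M ⊗_k K` as `R ⊗_k K`-modules, i.e. compatibly with both actions
    (letI := vRestrict k R Q
     letI : Module k M := Module.compHom M (algebraMap k R)
     ∃ f : LocalizedModule (Submonoid.powers (degT k)) Q ≃+ (M ⊗[k] DegK k),
       (∀ (c : DegK k) (x : LocalizedModule (Submonoid.powers (degT k)) Q),
          f (c • x) = LinearMap.lTensor M (LinearMap.mulLeft k c) (f x)) ∧
       (∀ (r : R) (x : LocalizedModule (Submonoid.powers (degT k)) Q),
          f (LocalizedModule.map (Submonoid.powers (degT k)) (rAct k R Q r) x)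
            = LinearMap.rTensor (DegK k) (rActK k R M r) (f x)))

end

/-- The ring `R = k[[x,y]]/(x³ + y²)`. -/
abbrev CuspRing (k : Type) [Field k] : Type :=
  MvPowerSeries (Fin 2) k ⧸
    Ideal.span {(MvPowerSeries.X (0 : Fin 2) : MvPowerSeries (Fin 2) k) ^ 3 + (MvPowerSeries.X (1 : Fin 2) : MvPowerSeries (Fin 2) k) ^ 2}

/-- The maximal ideal `𝔪 = (x, y)` of `R = k[[x,y]]/(x³ + y²)`. -/
def cuspMax (k : Type) [Field k] : Ideal (CuspRing k) :=
  Ideal.span {Ideal.Quotient.mk _ ((MvPowerSeries.X (0 : Fin 2) : MvPowerSeries (Fin 2) k)), Ideal.Quotient.mk _ ((MvPowerSeries.X (1 : Fin 2) : MvPowerSeries (Fin 2) k))}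


section SES
open MvPowerSeries

theorem X_dvd_of_dvd_X_mul {k : Type} [Field k] (i j : Fin 2) (hij : i ≠ j)
    (u : MvPowerSeries (Fin 2) k) (h : X i ∣ X j * u) : X i ∣ u := by
  rw [MvPowerSeries.X_dvd_iff] at h ⊢
  intro m hm
  have := h (Finsupp.single j 1 + m) (by simp [hm, hij.symm])
  rwa [MvPowerSeries.X, MvPowerSeries.coeff_add_monomial_mul, one_mul] at this

variable (k : Type) [Field k]

/-- residue class of `x` -/
def cx : CuspRing k := Ideal.Quotient.mk _ (X 0)
/-- residue class of `y` -/
def cy : CuspRing k := Ideal.Quotient.mk _ (X 1)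

theorem cx_cy : cx k ^ 3 + cy k ^ 2 = 0 := by
  rw [cx, cy, ← map_pow, ← map_pow, ← map_add, Ideal.Quotient.eq_zero_iff_mem]
  exact Ideal.subset_span rfl

theorem cuspMax_eq : cuspMax k = Ideal.span {cx k, cy k} := rfl

theorem cx_mul_eq_zero (a : CuspRing k) (h : a * cx k = 0) : a = 0 := by
  obtain ⟨a, rfl⟩ := Ideal.Quotient.mk_surjective a
  rw [cx, ← map_mul, Ideal.Quotient.eq_zero_iff_mem, Ideal.mem_span_singleton] at h
  obtain ⟨c, hc⟩ := h
  have h1 : (X 0 : MvPowerSeries (Fin 2) k) ∣ X 1 * (X 1 * c) :=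
    ⟨a - X 0 ^ 2 * c, by linear_combination -hc⟩
  have h2 := X_dvd_of_dvd_X_mul 0 1 (by decide) _ (X_dvd_of_dvd_X_mul 0 1 (by decide) _ h1)
  obtain ⟨d, rfl⟩ := h2
  rw [Ideal.Quotient.eq_zero_iff_mem, Ideal.mem_span_singleton]
  refine ⟨d, ?_⟩
  have hX : (X 0 : MvPowerSeries (Fin 2) k) ≠ 0 := by
    intro h
    have := congrArg (MvPowerSeries.coeff (Finsupp.single 0 1)) h
    simp [MvPowerSeries.coeff_X] at this
  exact mul_left_cancel₀ hX (by linear_combination hc)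

theorem snd_mem (a b : CuspRing k) (h : a * cx k + b * cy k = 0) : b ∈ cuspMax k := by
  obtain ⟨a, rfl⟩ := Ideal.Quotient.mk_surjective a
  obtain ⟨b, rfl⟩ := Ideal.Quotient.mk_surjective b
  rw [cx, cy, ← map_mul, ← map_mul, ← map_add, Ideal.Quotient.eq_zero_iff_mem,
    Ideal.mem_span_singleton] at h
  obtain ⟨c, hc⟩ := h
  have h1 : (X 0 : MvPowerSeries (Fin 2) k) ∣ X 1 * (b - X 1 * c) :=
    ⟨X 0 ^ 2 * c - a, by linear_combination hc⟩
  obtain ⟨d, hd⟩ := X_dvd_of_dvd_X_mul 0 1 (by decide) _ h1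
  rw [cuspMax_eq, Ideal.mem_span_pair]
  refine ⟨Ideal.Quotient.mk _ d, Ideal.Quotient.mk _ c, ?_⟩
  rw [cx, cy, ← map_mul, ← map_mul, ← map_add]
  congr 1
  linear_combination -hd

/-- the map `(a, b) ↦ a x + b y` -/
def cg : (Fin 2 → CuspRing k) →ₗ[CuspRing k] ↥(cuspMax k) :=
  LinearMap.codRestrict (cuspMax k)
    ((LinearMap.proj 0).smulRight (cx k) + (LinearMap.proj 1).smulRight (cy k))
    (fun v => by
      rw [cuspMax_eq, Ideal.mem_span_pair]
      exact ⟨v 0, v 1, rfl⟩)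

theorem cg_apply (v : Fin 2 → CuspRing k) : (cg k v : CuspRing k) = v 0 * cx k + v 1 * cy k := rfl

theorem cg_surj : Function.Surjective (cg k) := by
  rintro ⟨m, hm⟩
  rw [cuspMax_eq, Ideal.mem_span_pair] at hm
  obtain ⟨a, b, h⟩ := hm
  exact ⟨![a, b], Subtype.ext h⟩

theorem mem_ker_cg (v : Fin 2 → CuspRing k) :
    v ∈ LinearMap.ker (cg k) ↔ v 0 * cx k + v 1 * cy k = 0 := by
  rw [LinearMap.mem_ker, ← cg_apply, Submodule.coe_eq_zero]

/-- the projection from the kernel to the maximal ideal -/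
def cproj : LinearMap.ker (cg k) →ₗ[CuspRing k] ↥(cuspMax k) :=
  LinearMap.codRestrict (cuspMax k) ((LinearMap.proj 1).comp (LinearMap.ker (cg k)).subtype)
    (fun v => snd_mem k _ _ ((mem_ker_cg k v.1).1 v.2))

theorem cproj_bij : Function.Bijective (cproj k) := by
  constructor
  · rw [← LinearMap.ker_eq_bot, LinearMap.ker_eq_bot']
    rintro ⟨v, hv⟩ h
    have h1 : v 1 = 0 := congrArg Subtype.val h
    rw [mem_ker_cg, h1, zero_mul, add_zero] at hv
    have h0 := cx_mul_eq_zero k _ hv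
    ext i
    fin_cases i
    · exact h0
    · exact h1
  · rintro ⟨m, hm⟩
    have hm' := hm
    rw [cuspMax_eq, Ideal.mem_span_pair] at hm'
    obtain ⟨a, b, h⟩ := hm'
    refine ⟨⟨![-a * cy k + b * cx k ^ 2, m], ?_⟩, rfl⟩
    rw [mem_ker_cg]
    simp only [Matrix.cons_val_zero, Matrix.cons_val_one]
    rw [← h]
    linear_combination b * cx_cy k

/-- the embedding of the maximal ideal in the free module of rank two -/
def cf : ↥(cuspMax k) →ₗ[CuspRing k] (Fin 2 → CuspRing k) :=
  (LinearMap.ker (cg k)).subtype.comp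
    (LinearEquiv.ofBijective (cproj k) (cproj_bij k)).symm.toLinearMap

theorem cf_inj : Function.Injective (cf k) :=
  (Submodule.injective_subtype _).comp (LinearEquiv.injective _)

theorem cf_range : LinearMap.range (cf k) = LinearMap.ker (cg k) := by
  rw [cf, LinearMap.range_comp, LinearEquiv.range, Submodule.map_top, Submodule.range_subtype]

theorem cuspMax_finite : Module.Finite (CuspRing k) (cuspMax k) :=
  Module.Finite.of_surjective (cg k) (cg_surj k)

end SES

section VV
variable (k : Type) [Field k]

instance : IsDomain (DegV k) :=
  inferInstanceAs (IsDomain (Localization.AtPrime (tIdeal k)))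
instance : IsLocalization.AtPrime (DegV k) (tIdeal k) :=
  inferInstanceAs (IsLocalization.AtPrime (Localization.AtPrime (tIdeal k)) (tIdeal k))
instance : IsDedekindDomain (DegV k) :=
  IsLocalization.isDedekindDomain k[X] (tIdeal k).primeCompl_le_nonZeroDivisors (DegV k)
instance : IsLocalization (Submonoid.powers (degT k)) (DegK k) :=
  inferInstanceAs (IsLocalization (Submonoid.powers (degT k)) (Localization (Submonoid.powers (degT k))))
instance : IsScalarTower k (DegV k) (DegK k) :=
  inferInstanceAs (IsScalarTower k (DegV k) (Localization (Submonoid.powers (degT k))))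
instance (Q : Type) [AddCommGroup Q] [Module (DegV k) Q] : IsScalarTower (DegV k) (DegK k) (LocalizedModule (Submonoid.powers (degT k)) Q) :=
  inferInstanceAs (IsScalarTower (DegV k) (Localization (Submonoid.powers (degT k))) (LocalizedModule (Submonoid.powers (degT k)) Q))

theorem degT_ne_zero : degT k ≠ 0 := by
  rw [degT, Ne, IsLocalization.to_map_eq_zero_iff (DegV k) (tIdeal k).primeCompl_le_nonZeroDivisors]
  exact Polynomial.X_ne_zero

theorem VK_injective : Function.Injective (algebraMap (DegV k) (DegK k)) :=
  IsLocalization.injective _ (powers_le_nonZeroDivisors_of_noZeroDivisors (degT_ne_zero k))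

theorem mem_tIdeal (p : k[X]) : p ∈ tIdeal k ↔ p.eval 0 = 0 := by
  rw [tIdeal, Ideal.mem_span_singleton, Polynomial.X_dvd_iff, Polynomial.coeff_zero_eq_eval_zero]

/-- evaluation at zero -/
def evR : DegV k →+* k :=
  IsLocalization.lift (M := (tIdeal k).primeCompl) (g := Polynomial.evalRingHom (0 : k))
    (fun s => by
      have := s.2
      rw [Ideal.mem_primeCompl_iff, mem_tIdeal] at this
      exact isUnit_iff_ne_zero.2 this)

theorem evR_algebraMap (p : k[X]) : evR k (algebraMap k[X] (DegV k) p) = p.eval 0 := by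
  rw [evR, IsLocalization.lift_eq]; rfl

/-- evaluation at zero -/
def ev : DegV k →ₐ[k] k :=
  { evR k with
    commutes' := fun c => by
      show evR k (algebraMap k (DegV k) c) = c
      rw [IsScalarTower.algebraMap_apply k k[X] (DegV k), evR_algebraMap]
      simp }

theorem ev_algebraMap (p : k[X]) : ev k (algebraMap k[X] (DegV k) p) = p.eval 0 :=
  evR_algebraMap k p

@[simp] theorem ev_degT : ev k (degT k) = 0 := by
  rw [degT, ev_algebraMap]; simp

theorem exists_tau (v : DegV k) : ∃ w, v - algebraMap k (DegV k) (ev k v) = degT k * w := by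
  have key : ∀ u : DegV k, ev k u = 0 → ∃ w, u = degT k * w := by
    intro u hu
    obtain ⟨p, s, rfl⟩ := IsLocalization.exists_mk'_eq (tIdeal k).primeCompl u
    have h1 := IsLocalization.mk'_spec (DegV k) p s
    have h2 := congrArg (ev k) h1
    rw [map_mul, hu, zero_mul, ev_algebraMap, eq_comm, ← mem_tIdeal, tIdeal,
      Ideal.mem_span_singleton] at h2
    obtain ⟨q, rfl⟩ := h2
    refine ⟨IsLocalization.mk' (DegV k) q s, ?_⟩
    rw [degT, IsLocalization.mul_mk'_eq_mk'_of_mul]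
  apply key
  rw [map_sub, AlgHom.commutes]
  simp

/-- the quotient `(v - v(0)) / t` -/
def tau : DegV k →ₗ[k] DegV k where
  toFun v := (exists_tau k v).choose
  map_add' v w := by
    apply mul_left_cancel₀ (degT_ne_zero k)
    rw [mul_add, ← (exists_tau k v).choose_spec, ← (exists_tau k w).choose_spec,
      ← (exists_tau k (v + w)).choose_spec]
    simp only [map_add]
    ring
  map_smul' c v := by
    apply mul_left_cancel₀ (degT_ne_zero k)
    rw [RingHom.id_apply, mul_smul_comm, ← (exists_tau k v).choose_spec,
      ← (exists_tau k (c • v)).choose_spec]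
    simp only [Algebra.smul_def, map_mul]
    simp [mul_sub]

theorem tau_spec (v : DegV k) : v = algebraMap k (DegV k) (ev k v) + degT k * tau k v := by
  have := (exists_tau k v).choose_spec
  rw [sub_eq_iff_eq_add'] at this
  exact this

theorem tau_mul (v : DegV k) : tau k (degT k * v) = v := by
  have := tau_spec k (degT k * v)
  rw [map_mul, ev_degT, zero_mul, map_zero, zero_add] at this
  exact (mul_left_cancel₀ (degT_ne_zero k) this).symm

theorem tau_one : tau k 1 = 0 := by
  have := tau_spec k 1
  rw [map_one, map_one, left_eq_add] at this
  exact (mul_eq_zero.1 this).resolve_left (degT_ne_zero k)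
end VV

section DEG
variable (k : Type) [Field k] (R : Type) [CommRing R] [Algebra k R]

/-- evaluation at `t = 0` on `R ⊗ V` -/
def eps : (R ⊗[k] DegV k) →ₐ[R] R :=
  Algebra.TensorProduct.lift (AlgHom.id R R) ((Algebra.ofId k R).comp (ev k))
    (fun _ _ => Commute.all _ _)

theorem eps_tmul (r : R) (v : DegV k) : eps k R (r ⊗ₜ v) = r * algebraMap k R (ev k v) := by
  simp [eps, Algebra.ofId_apply]

/-- the element `1 ⊗ t` -/
def TT : R ⊗[k] DegV k := (1 : R) ⊗ₜ[k] degT k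

theorem eps_TT : eps k R (TT k R) = 0 := by
  rw [TT, eps_tmul]; simp

/-- division by `t` on `R ⊗ V` -/
def tauA : (R ⊗[k] DegV k) →ₗ[R] (R ⊗[k] DegV k) :=
  TensorProduct.AlgebraTensorModule.map LinearMap.id (tau k)

theorem tauA_tmul (r : R) (v : DegV k) : tauA k R (r ⊗ₜ v) = r ⊗ₜ tau k v := rfl

theorem tauA_spec (a : R ⊗[k] DegV k) :
    a = algebraMap R _ (eps k R a) + TT k R * tauA k R a := by
  induction a with
  | zero => simp
  | tmul r v =>
    rw [eps_tmul, tauA_tmul, TT, Algebra.TensorProduct.tmul_mul_tmul, one_mul]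
    conv_lhs => rw [tau_spec k v, TensorProduct.tmul_add]
    congr 1
    rw [Algebra.TensorProduct.algebraMap_apply, Algebra.algebraMap_self_apply, mul_comm, ← Algebra.smul_def,
      TensorProduct.smul_tmul, Algebra.algebraMap_eq_smul_one]
  | add x y hx hy =>
    rw [map_add, map_add, map_add, mul_add]
    conv_lhs => rw [hx, hy]
    ring

theorem tauA_TT (a : R ⊗[k] DegV k) : tauA k R (TT k R * a) = a := by
  induction a with
  | zero => simp
  | tmul r v => rw [TT, Algebra.TensorProduct.tmul_mul_tmul, one_mul, tauA_tmul, tau_mul]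
  | add x y hx hy => rw [mul_add, map_add, hx, hy]

theorem tauA_algebraMap (r : R) : tauA k R (algebraMap R _ r) = 0 := by
  rw [Algebra.TensorProduct.algebraMap_apply, tauA_tmul, tau_one, TensorProduct.tmul_zero]

theorem eps_algebraMap (r : R) : eps k R (algebraMap R _ r) = r := by
  rw [AlgHom.commutes]; rfl

theorem one_tmul_mul_inj (v : DegV k) (hv : v ≠ 0) (a : R ⊗[k] DegV k)
    (h : ((1 : R) ⊗ₜ[k] v) * a = 0) : a = 0 := by
  have h1 : Function.Injective (LinearMap.mulLeft k v) := mul_right_injective₀ hv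
  have h2 := Module.Flat.lTensor_preserves_injective_linearMap (M := R) _ h1
  have h3 : ∀ b : R ⊗[k] DegV k,
      LinearMap.lTensor R (LinearMap.mulLeft k v) b = ((1 : R) ⊗ₜ[k] v) * b := by
    intro b
    induction b with
    | zero => simp
    | tmul r w => simp
    | add x y hx hy => rw [map_add, hx, hy, mul_add]
  apply h2
  rw [map_zero, h3, h]

/-- the map from `R ⊗ V` to `K ⊗ R` -/
def J0 : (R ⊗[k] DegV k) →ₐ[k] (DegK k ⊗[k] R) :=
  Algebra.TensorProduct.lift Algebra.TensorProduct.includeRight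
    (Algebra.TensorProduct.includeLeft.comp (IsScalarTower.toAlgHom k (DegV k) (DegK k)))
    (fun _ _ => Commute.all _ _)

theorem J0_tmul (r : R) (v : DegV k) : J0 k R (r ⊗ₜ v) = algebraMap (DegV k) (DegK k) v ⊗ₜ r := by
  simp [J0]

theorem J0_inj : Function.Injective (J0 k R) := by
  have h2 := Module.Flat.lTensor_preserves_injective_linearMap (M := R)
    (IsScalarTower.toAlgHom k (DegV k) (DegK k)).toLinearMap (VK_injective k)
  have h3 : (J0 k R).toLinearMap = (TensorProduct.comm k R (DegK k)).toLinearMap ∘ₗ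
      LinearMap.lTensor R (IsScalarTower.toAlgHom k (DegV k) (DegK k)).toLinearMap := by
    ext; simp [J0_tmul]
  have h4 : ⇑(J0 k R) = (TensorProduct.comm k R (DegK k)) ∘
      LinearMap.lTensor R (IsScalarTower.toAlgHom k (DegV k) (DegK k)).toLinearMap := by
    funext x; exact LinearMap.congr_fun h3 x
  rw [h4]
  exact (LinearEquiv.injective _).comp h2

theorem J0_smul (v : DegV k) (a : R ⊗[k] DegV k) :
    J0 k R (((1 : R) ⊗ₜ[k] v) * a) = v • J0 k R a := by
  rw [map_mul, J0_tmul, ← algebraMap_smul (DegK k) v, Algebra.smul_def,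
    Algebra.TensorProduct.algebraMap_apply]
  rfl

theorem J0_surj (z : DegK k ⊗[k] R) : ∃ (n : ℕ) (a : R ⊗[k] DegV k),
    degT k ^ n • z = J0 k R a := by
  induction z with
  | zero => exact ⟨0, 0, by simp⟩
  | tmul c r =>
    obtain ⟨⟨v, s⟩, h⟩ := IsLocalization.surj (Submonoid.powers (degT k)) c
    obtain ⟨n, hn⟩ := s.2
    refine ⟨n, r ⊗ₜ v, ?_⟩
    simp only at hn h
    rw [J0_tmul, ← h, ← hn, TensorProduct.smul_tmul', Algebra.smul_def, mul_comm]
  | add x y hx hy =>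
    obtain ⟨n, a, ha⟩ := hx
    obtain ⟨m, b, hb⟩ := hy
    refine ⟨n + m, ((1 : R) ⊗ₜ[k] (degT k ^ m)) * a + ((1 : R) ⊗ₜ[k] (degT k ^ n)) * b, ?_⟩
    rw [map_add, J0_smul, J0_smul, ← ha, ← hb, smul_add, ← mul_smul, ← mul_smul, ← pow_add,
      ← pow_add, add_comm m n]

/-- the action of `r` on `(K ⊗ R)^2` -/
def actK (r : R) : (Fin 2 → DegK k ⊗[k] R) →ₗ[DegK k] (Fin 2 → DegK k ⊗[k] R) :=
  (LinearMap.mulLeft (DegK k) ((1 : DegK k) ⊗ₜ[k] r)).compLeft (Fin 2)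

theorem pi_iso (i : Module k (Fin 2 → R))
    (hi : ∀ (c : k) (m : Fin 2 → R), i.toSMul.smul c m = algebraMap k R c • m) :
    ∃ E : (Fin 2 → DegK k ⊗[k] R) ≃+ ((Fin 2 → R) ⊗[k] DegK k),
      (∀ (c : DegK k) w, E (c • w) = LinearMap.lTensor (Fin 2 → R) (LinearMap.mulLeft k c) (E w)) ∧
      (∀ (r : R) (act : (Fin 2 → R) →ₗ[k] (Fin 2 → R)), (∀ m, act m = r • m) → ∀ w,
        E (actK k R r w) = LinearMap.rTensor (DegK k) act (E w)) := by
  obtain rfl : i = Pi.module (Fin 2) (fun _ => R) k := by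
    apply Module.ext
    funext c m
    refine (hi c m).trans ?_
    funext j
    exact (Algebra.smul_def c (m j)).symm
  let P := TensorProduct.piRight k (DegK k) (DegK k) (fun _ : Fin 2 => R)
  let C := TensorProduct.comm k (DegK k) (Fin 2 → R)
  refine ⟨P.symm.toAddEquiv.trans C.toAddEquiv, ?_, ?_⟩
  · intro c w
    show C (P.symm (c • w)) = LinearMap.lTensor (Fin 2 → R) (LinearMap.mulLeft k c) (C (P.symm w))
    rw [map_smul]
    generalize P.symm w = z
    induction z with
    | zero => simp
    | tmul a b => simp [C, TensorProduct.smul_tmul']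
    | add x y hx hy => rw [smul_add, map_add, map_add, map_add, hx, hy]
  · intro r act hact w
    show C (P.symm (actK k R r w)) = LinearMap.rTensor (DegK k) act (C (P.symm w))
    obtain ⟨z, rfl⟩ := P.surjective w
    rw [P.symm_apply_apply]
    induction z with
    | zero => simp
    | tmul a b =>
      have : actK k R r (P (a ⊗ₜ b)) = P (a ⊗ₜ (r • b)) := by
        funext j
        simp [P, actK]
      rw [this, P.symm_apply_apply]
      simp [C, hact]
    | add x y hx hy => rw [map_add, map_add, map_add, map_add, hx, hy, map_add, map_add]

variable {N : Type} [AddCommGroup N] [Module R N] (g : (Fin 2 → R) →ₗ[R] N)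

/-- componentwise evaluation at `t = 0` -/
def rho : (Fin 2 → R ⊗[k] DegV k) →ₗ[R] (Fin 2 → R) := (eps k R).toLinearMap.compLeft (Fin 2)

/-- componentwise division by `t` -/
def tau2 : (Fin 2 → R ⊗[k] DegV k) →ₗ[R] (Fin 2 → R ⊗[k] DegV k) := (tauA k R).compLeft (Fin 2)

/-- constants -/
def cst : (Fin 2 → R) →ₗ[R] (Fin 2 → R ⊗[k] DegV k) :=
  (Algebra.linearMap R (R ⊗[k] DegV k)).compLeft (Fin 2)

theorem rho_smul (a : R ⊗[k] DegV k) (q : Fin 2 → R ⊗[k] DegV k) :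
    rho k R (a • q) = eps k R a • rho k R q := by
  funext j
  exact map_mul (eps k R) a (q j)

theorem rho_cst (m : Fin 2 → R) : rho k R (cst k R m) = m := by
  funext j
  exact eps_algebraMap k R (m j)

theorem tau2_cst (m : Fin 2 → R) : tau2 k R (cst k R m) = 0 := by
  funext j
  exact tauA_algebraMap k R (m j)

theorem tau2_TT (q : Fin 2 → R ⊗[k] DegV k) : tau2 k R (TT k R • q) = q := by
  funext j
  exact tauA_TT k R (q j)

theorem tau2_spec (q : Fin 2 → R ⊗[k] DegV k) :
    q = cst k R (rho k R q) + TT k R • tau2 k R q := by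
  funext j
  exact tauA_spec k R (q j)

theorem rho_TT (q : Fin 2 → R ⊗[k] DegV k) : rho k R (TT k R • q) = 0 := by
  rw [rho_smul, eps_TT, zero_smul]

/-- the degenerating family -/
def QQ : Submodule (R ⊗[k] DegV k) (Fin 2 → R ⊗[k] DegV k) where
  carrier := {q | g (rho k R q) = 0}
  add_mem' := by
    intro a b ha hb
    simp only [Set.mem_ofPred_eq] at ha hb ⊢
    rw [map_add, map_add, ha, hb, add_zero]
  zero_mem' := by simp
  smul_mem' := by
    intro c q hq
    simp only [Set.mem_ofPred_eq] at hq ⊢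
    rw [rho_smul, map_smul, hq, smul_zero]

theorem mem_QQ (q : Fin 2 → R ⊗[k] DegV k) : q ∈ QQ k R g ↔ g (rho k R q) = 0 := Iff.rfl

theorem TT_mem (q : Fin 2 → R ⊗[k] DegV k) : TT k R • q ∈ QQ k R g := by
  rw [mem_QQ, rho_TT, map_zero]

theorem cst_smul (r : R) (m : Fin 2 → R) :
    cst k R (r • m) = algebraMap R (R ⊗[k] DegV k) r • cst k R m := by
  rw [map_smul, algebraMap_smul]

theorem QQ_finite {L : Type} [AddCommGroup L] [Module R L] [Module.Finite R L]
    (f : L →ₗ[R] (Fin 2 → R)) (hfg : LinearMap.range f = LinearMap.ker g) :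
    Module.Finite (R ⊗[k] DegV k) (QQ k R g) := by
  classical
  rw [Module.Finite.iff_fg]
  obtain ⟨S, hS⟩ := Module.Finite.fg_top (R := R) (M := L)
  obtain ⟨B, hB⟩ := Module.Finite.fg_top (R := R ⊗[k] DegV k) (M := Fin 2 → R ⊗[k] DegV k)
  refine ⟨S.image (fun l => cst k R (f l)) ∪ B.image (fun b => TT k R • b), ?_⟩
  rw [Finset.coe_union, Finset.coe_image, Finset.coe_image]
  apply le_antisymm
  · rw [Submodule.span_le]
    rintro _ (⟨l, _, rfl⟩ | ⟨b, _, rfl⟩)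
    · show cst k R (f l) ∈ QQ k R g
      rw [mem_QQ, rho_cst]
      have : f l ∈ LinearMap.ker g := hfg ▸ LinearMap.mem_range_self f l
      exact this
    · exact TT_mem k R g b
  · intro q hq
    rw [tau2_spec k R q]
    rw [Submodule.span_union]
    apply Submodule.add_mem_sup
    · have : rho k R q ∈ LinearMap.range f := by rw [hfg]; exact hq
      obtain ⟨l, hl⟩ := this
      rw [← hl]
      have hl' : l ∈ Submodule.span R (S : Set L) := by rw [hS]; trivial
      clear hl
      induction hl' using Submodule.span_induction with
      | mem x hx => exact Submodule.subset_span ⟨x, hx, rfl⟩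
      | zero => simp
      | add x y _ _ hx hy => rw [map_add, map_add]; exact add_mem hx hy
      | smul r x _ hx =>
        rw [map_smul, cst_smul]
        exact Submodule.smul_mem _ _ hx
    · have hl' : tau2 k R q ∈ Submodule.span (R ⊗[k] DegV k) (B : Set _) := by rw [hB]; trivial
      generalize tau2 k R q = w at hl'
      induction hl' using Submodule.span_induction with
      | mem x hx => exact Submodule.subset_span ⟨x, hx, rfl⟩
      | zero => simp
      | add x y _ _ hx hy => rw [smul_add]; exact add_mem hx hy
      | smul r x _ hx =>
        rw [smul_comm]
        exact Submodule.smul_mem _ _ hx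

theorem QQ_flat : letI := vRestrict k R (QQ k R g); Module.Flat (DegV k) (QQ k R g) := by
  letI := vRestrict k R (QQ k R g)
  have : Module.IsTorsionFree (DegV k) (QQ k R g) := by
    apply Module.IsTorsionFree.of_smul_eq_zero
    intro v q h
    by_cases hv : v = 0
    · exact Or.inl hv
    · right
      ext j
      exact one_tmul_mul_inj k R v hv (q.1 j) (congrFun (congrArg Subtype.val h) j)
  exact inferInstance

theorem QQ_quot {L : Type} [AddCommGroup L] [Module R L]
    (f : L →ₗ[R] (Fin 2 → R)) (hf : Function.Injective f) (hg : Function.Surjective g)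
    (hfg : LinearMap.range f = LinearMap.ker g) :
    letI := rRestrict k R ((QQ k R g) ⧸ LinearMap.range (tSmul k R (QQ k R g)))
    Nonempty (((QQ k R g) ⧸ LinearMap.range (tSmul k R (QQ k R g))) ≃ₗ[R] (L × N)) := by
  letI i1 := rRestrict k R ((QQ k R g) ⧸ LinearMap.range (tSmul k R (QQ k R g)))
  have hsm : ∀ (r : R) (q : QQ k R g), ((r • q : QQ k R g) : Fin 2 → R ⊗[k] DegV k) = r • q.1 := by
    intro r q
    rfl
  let e := LinearEquiv.ofInjective f hf
  have hmem : ∀ q : QQ k R g, rho k R q.1 ∈ LinearMap.range f := fun q => by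
    rw [hfg]; exact q.2
  have he : ∀ (q : QQ k R g), f (e.symm ⟨_, hmem q⟩) = rho k R q.1 := fun q =>
    congrArg Subtype.val (e.apply_symm_apply ⟨_, hmem q⟩)
  let φ : (QQ k R g) →ₗ[R] (L × N) :=
    { toFun := fun q => (e.symm ⟨_, hmem q⟩, g (rho k R (tau2 k R q.1)))
      map_add' := fun a b => by
        refine Prod.ext (hf ?_) ?_
        · simp only [Prod.fst_add, map_add f]
          rw [he, he, he, Submodule.coe_add, map_add]
        · simp
      map_smul' := fun r a => by
        refine Prod.ext (hf ?_) ?_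
        · simp only [Prod.smul_fst, map_smul f, RingHom.id_apply]
          rw [he, he, hsm, map_smul]
        · simp only [Prod.smul_snd, RingHom.id_apply]
          rw [hsm, map_smul, map_smul, map_smul] }
  let π : (QQ k R g) →ₗ[R] ((QQ k R g) ⧸ LinearMap.range (tSmul k R (QQ k R g))) :=
    { toFun := Submodule.Quotient.mk
      map_add' := fun a b => rfl
      map_smul' := fun r a => by
        rw [← algebraMap_smul (R ⊗[k] DegV k) r a]
        rfl }
  have hπ : Function.Surjective π := Submodule.Quotient.mk_surjective _
  have hφ : Function.Surjective φ := by
    rintro ⟨l, n⟩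
    obtain ⟨m, rfl⟩ := hg n
    have hl : g (f l) = 0 := by
      have : f l ∈ LinearMap.ker g := hfg ▸ LinearMap.mem_range_self f l
      exact this
    refine ⟨⟨cst k R (f l) + TT k R • cst k R m, ?_⟩, ?_⟩
    · rw [mem_QQ, map_add, rho_cst, rho_TT, add_zero, hl]
    · refine Prod.ext (hf ?_) ?_
      · refine (he _).trans ?_
        rw [map_add, rho_cst, rho_TT, add_zero]
      · show g (rho k R (tau2 k R (cst k R (f l) + TT k R • cst k R m))) = g m
        rw [map_add, tau2_cst, tau2_TT, zero_add, rho_cst]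
  have hker : LinearMap.ker π = LinearMap.ker φ := by
    ext q
    have h1 : q ∈ LinearMap.ker π ↔ q ∈ LinearMap.range (tSmul k R (QQ k R g)) := by
      rw [LinearMap.mem_ker]
      exact Submodule.Quotient.mk_eq_zero _
    rw [h1, LinearMap.mem_ker]
    constructor
    · rintro ⟨q', rfl⟩
      have hv : ((tSmul k R (QQ k R g) q' : QQ k R g) : Fin 2 → R ⊗[k] DegV k) = TT k R • q'.1 := rfl
      refine Prod.ext (hf ?_) ?_
      · refine (he _).trans ?_
        rw [hv, rho_TT]; exact (map_zero f).symm
      · show g (rho k R (tau2 k R (tSmul k R (QQ k R g) q' : QQ k R g).1)) = 0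
        rw [hv, tau2_TT]
        exact q'.2
    · intro h
      have ha : rho k R q.1 = 0 := by
        rw [← he]
        have : e.symm ⟨_, hmem q⟩ = 0 := congrArg Prod.fst h
        rw [this, map_zero]
      have hb : g (rho k R (tau2 k R q.1)) = 0 := congrArg Prod.snd h
      refine ⟨⟨tau2 k R q.1, hb⟩, Subtype.ext ?_⟩
      show TT k R • tau2 k R q.1 = q.1
      conv_rhs => rw [tau2_spec k R q.1, ha, map_zero, zero_add]
  exact ⟨(LinearMap.quotKerEquivOfSurjective π hπ).symm.trans
    ((Submodule.quotEquivOfEq _ _ hker).trans (LinearMap.quotKerEquivOfSurjective φ hφ))⟩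

theorem QQ_loc : letI := vRestrict k R (QQ k R g)
    ∃ f : LocalizedModule (Submonoid.powers (degT k)) (QQ k R g) ≃+ (Fin 2 → DegK k ⊗[k] R),
       (∀ (c : DegK k) (x : LocalizedModule (Submonoid.powers (degT k)) (QQ k R g)),
          f (c • x) = c • (f x)) ∧
       (∀ (r : R) (x : LocalizedModule (Submonoid.powers (degT k)) (QQ k R g)),
          f (LocalizedModule.map (Submonoid.powers (degT k)) (rAct k R (QQ k R g) r) x)
            = actK k R r (f x)) := by
  letI := vRestrict k R (QQ k R g)
  have hsm : ∀ (v : DegV k) (q : QQ k R g) (j : Fin 2),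
      (v • q : QQ k R g).1 j = ((1 : R) ⊗ₜ[k] v) * q.1 j := fun v q j => rfl
  let j : QQ k R g →ₗ[DegV k] (Fin 2 → DegK k ⊗[k] R) :=
    { toFun := fun q i => J0 k R (q.1 i)
      map_add' := fun a b => by funext i; simp
      map_smul' := fun v q => by
        funext i
        rw [hsm, J0_smul]
        rfl }
  have hT : (1 : R) ⊗ₜ[k] degT k = TT k R := rfl
  have hunit : ∀ s : Submonoid.powers (degT k),
      IsUnit (algebraMap (DegV k) (Module.End (DegV k) (Fin 2 → DegK k ⊗[k] R)) s) := by
    intro s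
    have hs : IsUnit (algebraMap (DegV k) (DegK k) s) := IsLocalization.map_units (DegK k) s
    rw [Module.End.isUnit_iff]
    have h2 : ∀ w : Fin 2 → DegK k ⊗[k] R, algebraMap (DegV k) (Module.End (DegV k) (Fin 2 → DegK k ⊗[k] R)) s w = hs.unit • w := by
      intro w
      rw [Module.algebraMap_end_apply, ← algebraMap_smul (DegK k)]
      rfl
    rw [show ⇑(algebraMap (DegV k) (Module.End (DegV k) (Fin 2 → DegK k ⊗[k] R)) s) = _ from funext h2]
    exact MulAction.bijective hs.unit
  haveI hloc : IsLocalizedModule (Submonoid.powers (degT k)) j :=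
    { map_units := hunit
      surj := by
        intro w
        obtain ⟨n0, a0, h0⟩ := J0_surj k R (w 0)
        obtain ⟨n1, a1, h1⟩ := J0_surj k R (w 1)
        refine ⟨(⟨TT k R • ![((1 : R) ⊗ₜ[k] (degT k ^ n1)) * a0, ((1 : R) ⊗ₜ[k] (degT k ^ n0)) * a1],
          TT_mem k R g _⟩, ⟨degT k ^ (n0 + n1 + 1), ⟨_, rfl⟩⟩), ?_⟩
        funext i
        show degT k ^ (n0 + n1 + 1) • w i = J0 k R (TT k R * _)
        rw [TT, J0_smul]
        fin_cases i
        · show degT k ^ (n0 + n1 + 1) • w 0 = degT k • J0 k R (((1 : R) ⊗ₜ[k] (degT k ^ n1)) * a0)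
          rw [J0_smul, ← h0, ← mul_smul, ← mul_smul]
          congr 1
          ring
        · show degT k ^ (n0 + n1 + 1) • w 1 = degT k • J0 k R (((1 : R) ⊗ₜ[k] (degT k ^ n0)) * a1)
          rw [J0_smul, ← h1, ← mul_smul, ← mul_smul]
          congr 1
          ring
      exists_of_eq := by
        intro a b h
        refine ⟨1, ?_⟩
        congr 1
        ext i
        exact J0_inj k R (congrFun h i) }
  let e := IsLocalizedModule.iso (Submonoid.powers (degT k)) j
  let e' := e.extendScalarsOfIsLocalization (Submonoid.powers (degT k)) (DegK k)
  refine ⟨e'.toAddEquiv, fun c x => map_smul e' c x, ?_⟩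
  intro r x
  let l1 : LocalizedModule (Submonoid.powers (degT k)) (QQ k R g) →ₗ[DegV k] (Fin 2 → DegK k ⊗[k] R) :=
    e.toLinearMap ∘ₗ
      (LocalizedModule.map (Submonoid.powers (degT k)) (rAct k R (QQ k R g) r)).restrictScalars (DegV k)
  let l2 : LocalizedModule (Submonoid.powers (degT k)) (QQ k R g) →ₗ[DegV k] (Fin 2 → DegK k ⊗[k] R) :=
    (actK k R r).restrictScalars (DegV k) ∘ₗ e.toLinearMap
  have hl : l1 = l2 := by
    apply IsLocalizedModule.ext (Submonoid.powers (degT k))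
      (LocalizedModule.mkLinearMap (Submonoid.powers (degT k)) (QQ k R g)) hunit
    ext q i
    have hj : ∀ q : QQ k R g, e (LocalizedModule.mk q 1) = j q := fun q => by
      rw [← IsLocalizedModule.iso_symm_apply (Submonoid.powers (degT k)) j]
      exact e.apply_symm_apply _
    show e (LocalizedModule.map (Submonoid.powers (degT k)) (rAct k R (QQ k R g) r) (LocalizedModule.mk q 1)) i
      = actK k R r (e (LocalizedModule.mk q 1)) i
    rw [LocalizedModule.map_mk, hj, hj]
    show J0 k R ((r ⊗ₜ[k] (1 : DegV k)) * q.1 i) = ((1 : DegK k) ⊗ₜ[k] r) * J0 k R (q.1 i)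
    rw [map_mul, J0_tmul, map_one]
  exact LinearMap.congr_fun hl x

theorem degenerates_of_ses {L N' : Type} [AddCommGroup L] [Module R L] [Module.Finite R L]
    [AddCommGroup N'] [Module R N'] (eN : (L × N) ≃ₗ[R] N')
    (f : L →ₗ[R] (Fin 2 → R)) (hf : Function.Injective f) (hg : Function.Surjective g)
    (hfg : LinearMap.range f = LinearMap.ker g) :
    Degenerates k R (Fin 2 → R) N' := by
  refine ⟨QQ k R g, inferInstance, inferInstance, QQ_finite k R g f hfg, QQ_flat k R g, ?_, ?_⟩
  · letI := rRestrict k R ((QQ k R g) ⧸ LinearMap.range (tSmul k R (QQ k R g)))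
    obtain ⟨e⟩ := QQ_quot k R g f hf hg hfg
    exact ⟨e.trans eN⟩
  · obtain ⟨F, hF1, hF2⟩ := QQ_loc k R g
    obtain ⟨E, hE1, hE2⟩ := pi_iso k R (Module.compHom (Fin 2 → R) (algebraMap k R)) (fun c m => rfl)
    refine ⟨F.trans E, ?_, ?_⟩
    · intro c x
      show E (F (c • x)) = _
      rw [hF1, hE1]
      rfl
    · intro r x
      show E (F _) = _
      rw [hF2]
      exact hE2 r (rActK k R (Fin 2 → R) r) (fun m => rfl) (F x)

end DEG

/-- there is a short exact sequence `0 → 𝔪 → R² → 𝔪 → 0`, and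
consequently `R² ⇒_deg 𝔪²`, over `R = k[[x,y]]/(x³ + y²)`. -/
theorem cusp_ses_and_degeneration (k : Type) [Field k] :
    (∃ (f : ↥(cuspMax k) →ₗ[CuspRing k] (Fin 2 → CuspRing k))
       (g : (Fin 2 → CuspRing k) →ₗ[CuspRing k] ↥(cuspMax k)),
       Function.Injective ⇑f ∧ Function.Surjective ⇑g ∧
       LinearMap.range f = LinearMap.ker g) ∧
    Degenerates k (CuspRing k) (Fin 2 → CuspRing k) (Fin 2 → ↥(cuspMax k)) := by
  refine ⟨⟨cf k, cg k, cf_inj k, cg_surj k, cf_range k⟩, ?_⟩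
  haveI := cuspMax_finite k
  exact degenerates_of_ses k (CuspRing k) (cg k) (LinearEquiv.finTwoArrow (CuspRing k) (cuspMax k)).symm
    (cf k) (cf_inj k) (cg_surj k) (cf_range k)
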